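/- Generalized expected list-size bound (Equation (19)): in the setting of the (2^{nR1}, ..., 2^{nRK}, n; p) random code ensemble over the (K, L)-DM-IN with D1 ⊆ S ⊆ [K] and with Mk = 1 for all k ∈ S^c, define the random list L = { m_{S^c} : (Q^n, (Xk^n(Mk))_{k ∈ D1}, (Xk^n(mk))_{k ∈ D1^c}, Y1^n) ∈ T_ε^{(n)}, with mk = 1 for all k ∈ D1^c ∩ S }. Then there is a function δ(ε) with δ(ε) → 0 as ε → 0 such that for all n, E(|L|) ≤ Σ over U ⊆ S^c of 2^{n( R_{S^c \ U} − I(X_{S^c \ U}; Y1 | X_S, X_U, Q) + δ(ε) )}, where R_A = Σ_{k∈A} Rk. -/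

import Mathlib

open scoped BigOperators
open Filter

set_option synthInstance.maxSize 4000
set_option synthInstance.maxHeartbeats 1000000
set_option maxHeartbeats 1000000

noncomputable section

/-- Shannon entropy (base 2) of a finitely supported distribution `p`. -/
def ent {α : Type*} [Fintype α] (p : α → ℝ) : ℝ := -∑ a, p a * Real.logb 2 (p a)

/-- The distribution (pushforward) of a random variable `f` on the finite
probability space `(Ω, p)`. -/
def distOf {Ω β : Type*} [Fintype Ω] [DecidableEq β] (p : Ω → ℝ) (f : Ω → β) : β → ℝ :=
  fun b => ∑ ω, if f ω = b then p ω else 0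

/-- The entropy `H(f)` of a random variable `f` on the finite probability space `(Ω, p)`. -/
def entOf {Ω β : Type*} [Fintype Ω] [Fintype β] [DecidableEq β] (p : Ω → ℝ) (f : Ω → β) : ℝ :=
  ent (distOf p f)

/-- The conditional entropy `H(f | g)`. -/
def condEnt {Ω β γ : Type*} [Fintype Ω] [Fintype β] [Fintype γ] [DecidableEq β] [DecidableEq γ]
    (p : Ω → ℝ) (f : Ω → β) (g : Ω → γ) : ℝ :=
  entOf p (fun ω => (f ω, g ω)) - entOf p g

/-- The mutual information `I(f; g)`. -/
def mutInfo {Ω β γ : Type*} [Fintype Ω] [Fintype β] [Fintype γ] [DecidableEq β] [DecidableEq γ]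
    (p : Ω → ℝ) (f : Ω → β) (g : Ω → γ) : ℝ :=
  entOf p f + entOf p g - entOf p (fun ω => (f ω, g ω))

/-- The conditional mutual information `I(f; g | h)`. -/
def condMutInfo {Ω β γ δ : Type*} [Fintype Ω] [Fintype β] [Fintype γ] [Fintype δ]
    [DecidableEq β] [DecidableEq γ] [DecidableEq δ]
    (p : Ω → ℝ) (f : Ω → β) (g : Ω → γ) (h : Ω → δ) : ℝ :=
  entOf p (fun ω => (f ω, h ω)) + entOf p (fun ω => (g ω, h ω)) -
    entOf p (fun ω => (f ω, g ω, h ω)) - entOf p h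

/-- `p` is a probability mass function on the finite alphabet `α`. -/
def IsPMF {α : Type*} [Fintype α] (p : α → ℝ) : Prop := (∀ a, 0 ≤ p a) ∧ ∑ a, p a = 1

/-- The number `2^{nR}` of messages at blocklength `n` and rate `R` (in bits). -/
def msgSize (n : ℕ) (R : ℝ) : ℕ := max 1 ⌊(2 : ℝ) ^ ((n : ℝ) * R)⌋₊

instance (n : ℕ) (R : ℝ) : NeZero (msgSize n R) :=
  ⟨by have h : 1 ≤ msgSize n R := le_max_left _ _; omega⟩

/-- The `ε`-typical set: `xs` is `ε`-typical for the pmf `p` if the empirical frequency of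
every symbol `a` is within `ε · p a` of `p a`. -/
def Typical {α : Type*} [Fintype α] [DecidableEq α] (p : α → ℝ) (ε : ℝ) {n : ℕ}
    (xs : Fin n → α) : Prop :=
  ∀ a, |((Finset.univ.filter fun i => xs i = a).card : ℝ) / (n : ℝ) - p a| ≤ ε * p a

section Network

variable {K L : ℕ} {Q : Type*} {X : Fin K → Type*} {Y : Fin L → Type*}
  [Fintype Q] [DecidableEq Q]
  [∀ k, Fintype (X k)] [∀ k, DecidableEq (X k)]
  [∀ l, Fintype (Y l)] [∀ l, DecidableEq (Y l)]

variable (pQ : Q → ℝ) (pX : ∀ k, Q → X k → ℝ) (W : (∀ k, X k) → (∀ l, Y l) → ℝ)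

/-- The single-letter joint distribution of `(Q, X_{[K]}, Y_{[L]})` induced by the input pmf
`p(q) p(x1|q) ⋯ p(xK|q)` and the channel `p(y_{[L]} | x_{[K]})`. -/
def NjointP : Q × (∀ k, X k) × (∀ l, Y l) → ℝ := fun z =>
  pQ z.1 * (∏ k, pX k z.1 (z.2.1 k)) * W z.2.1 z.2.2

/-- The rate region `𝓡_l(p)` for receiver `l` with demand set `Dl`: the union over all
`S ⊇ Dl` of the MAC regions `𝓡_{MAC(S, l)}(p)`. -/
def NRegion (Dl : Finset (Fin K)) (l : Fin L) : Set (Fin K → ℝ) :=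
  {R | (∀ k, 0 ≤ R k) ∧ ∃ S : Finset (Fin K), Dl ⊆ S ∧
    ∀ T ⊆ S, ∑ k ∈ T, R k ≤
      condMutInfo (NjointP pQ pX W)
        (fun z => fun k : {k // k ∈ T} => z.2.1 k.1)
        (fun z => z.2.2 l)
        (fun z => ((fun k : {k // k ∈ S \ T} => z.2.1 k.1), z.1))}

/-- A codebook for the `(K, L)` interference network. -/
abbrev NCodebook (Q : Type*) {K : ℕ} (X : Fin K → Type*) (n : ℕ) (M : Fin K → ℕ) : Type _ :=
  (Fin n → Q) × ∀ k, Fin (M k) → Fin n → X k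

/-- The probability of a codebook under the `p`-distributed random code ensemble. -/
def NensembleP {n : ℕ} {M : Fin K → ℕ} (c : NCodebook Q X n M) : ℝ :=
  (∏ i, pQ (c.1 i)) * ∏ k, ∏ m, ∏ i, pX k (c.1 i) (c.2 k m i)

/-- The average probability of error of the code given by codebook `c` and decoders `d`
(receiver `l` errs if it misdecodes some message demanded by `D l`). -/
def NPeCode (D : Fin L → Finset (Fin K)) {n : ℕ} {M : Fin K → ℕ}
    (c : NCodebook Q X n M) (d : ∀ l, (Fin n → Y l) → ∀ k, Fin (M k)) : ℝ :=
  (∏ k, (M k : ℝ))⁻¹ * ∑ m : ∀ k, Fin (M k), ∑ y : ∀ l, Fin n → Y l,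
    (∏ i, W (fun k => c.2 k (m k) i) (fun l => y l i)) *
      (if ∀ l, ∀ k ∈ D l, d l (y l) k = m k then 0 else 1)

/-- The probability of error of the codebook `c` under optimal (maximum likelihood)
decoding. -/
def NPeOpt (D : Fin L → Finset (Fin K)) {n : ℕ} {M : Fin K → ℕ}
    (c : NCodebook Q X n M) : ℝ :=
  ⨅ d : ∀ l, (Fin n → Y l) → ∀ k, Fin (M k), NPeCode W D c d

/-- The probability of error under optimal decoding at blocklength `n` and rate tuple `R`,
averaged over the random code ensemble. -/
def NavgPeOpt (D : Fin L → Finset (Fin K)) (R : Fin K → ℝ) (n : ℕ) : ℝ :=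
  ∑ c : NCodebook Q X n (fun k => msgSize n (R k)),
    NensembleP pQ pX c * NPeOpt W D c

/-- The sample space of the experiment in which the messages of the senders outside `S` are
fixed to `1`: a random codebook, uniform messages for the senders in `S`, and the channel
output sequences. -/
abbrev NExpSpaceS (Q : Type*) {K L : ℕ} (X : Fin K → Type*) (Y : Fin L → Type*)
    (S : Finset (Fin K)) (n : ℕ) (M : Fin K → ℕ) : Type _ :=
  NCodebook Q X n M × (∀ k : {k // k ∈ S}, Fin (M k.1)) × (∀ l, Fin n → Y l)

/-- The joint distribution of the experiment in which `M_k = 1` for all `k ∈ Sᶜ`: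
the codebook is drawn from the random code ensemble, the messages `M_k`, `k ∈ S`, are
independent and uniform, the senders outside `S` transmit the codeword of their first
message, and the outputs are produced by the memoryless channel. -/
def NexpPS (S : Finset (Fin K)) {n : ℕ} {M : Fin K → ℕ} [∀ k, NeZero (M k)] :
    NExpSpaceS Q X Y S n M → ℝ := fun ω =>
  NensembleP pQ pX ω.1 * (∏ k : {k // k ∈ S}, (M k.1 : ℝ))⁻¹ *
    ∏ i, W (fun k => if h : k ∈ S then ω.1.2 k (ω.2.1 ⟨k, h⟩) i else ω.1.2 k 0 i)
      (fun l => ω.2.2 l i)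

section FiniteProbability

/-- The entropy of `f` is the expectation of minus the log-likelihood of `f`. -/
theorem entOf_eq_neg_sum {Ω β : Type*} [Fintype Ω] [Fintype β] [DecidableEq β]
    (p : Ω → ℝ) (f : Ω → β) :
    entOf p f = -∑ ω, p ω * Real.logb 2 (distOf p f (f ω)) := by
  unfold entOf ent
  congr 1
  conv_lhs => enter [2, b]; rw [distOf, Finset.sum_mul]
  rw [Finset.sum_comm]
  refine Finset.sum_congr rfl fun ω _ => ?_
  simp [ite_mul, distOf]

/-- Change of variables for expectations on a finite probability space. -/
theorem sum_distOf_mul {Ω β : Type*} [Fintype Ω] [Fintype β] [DecidableEq β]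
    (p : Ω → ℝ) (f : Ω → β) (φ : β → ℝ) :
    ∑ b, distOf p f b * φ b = ∑ ω, p ω * φ (f ω) := by
  simp only [distOf, Finset.sum_mul]
  rw [Finset.sum_comm]
  simp [ite_mul]

/-- Coordinatewise pushforward of a product weight. -/
theorem sum_pi_map {ι : Type*} [Fintype ι] [DecidableEq ι] {D E : ι → Type*}
    [∀ i, Fintype (D i)] [∀ i, Fintype (E i)] [∀ i, DecidableEq (E i)]
    (ν : ∀ i, D i → ℝ) (π : ∀ i, D i → E i) (Φ : (∀ i, E i) → ℝ) :
    ∑ c : ∀ i, D i, (∏ i, ν i (c i)) * Φ (fun i => π i (c i)) =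
      ∑ e : ∀ i, E i, (∏ i, distOf (ν i) (π i) (e i)) * Φ e := by
  classical
  have h : ∀ e : ∀ i, E i, (∏ i, distOf (ν i) (π i) (e i)) =
      distOf (fun c : ∀ i, D i => ∏ i, ν i (c i)) (fun c i => π i (c i)) e := by
    intro e
    simp only [distOf]
    rw [Finset.prod_univ_sum, Fintype.piFinset_univ]
    refine Finset.sum_congr rfl fun c _ => ?_
    rw [Finset.prod_ite_zero]
    simp [funext_iff]
  simp only [h]
  exact (sum_distOf_mul _ _ _).symm

/-- The conditional law of a coordinate `a` given its reference value `b`: a fresh draw from `μ`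
if `P` holds, and a copy of `b` otherwise. -/
def resample {V : Type*} [DecidableEq V] (μ : V → ℝ) (P : Prop) [Decidable P] (b a : V) : ℝ :=
  if P then μ a else if a = b then 1 else 0

section Resample

variable {V : Type*} [DecidableEq V] {μ : V → ℝ} (P : Prop) [Decidable P]

theorem resample_nonneg (hμ : ∀ a, 0 ≤ μ a) (b a : V) : 0 ≤ resample μ P b a := by
  unfold resample
  split_ifs <;> first | exact hμ a | norm_num

theorem sum_resample [Fintype V] (hμ : ∑ a, μ a = 1) (b : V) : ∑ a, resample μ P b a = 1 := by
  unfold resample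
  split_ifs <;> simp [hμ]

theorem resample_self_pos {b : V} (hb : 0 < μ b) : 0 < resample μ P b b := by
  by_cases hP : P <;> simp [resample, hP, hb]

/-- The resampling kernel is reversible. -/
theorem mul_resample_comm (b a : V) : μ b * resample μ P b a = μ a * resample μ P a b := by
  unfold resample
  split_ifs with h1 h2 h3 h3
  · ring
  · rw [h2]
  · exact absurd h2.symm h3
  · exact absurd h3.symm h2
  · simp

/-- The law of two entries of an i.i.d. family. -/
theorem distOf_pair_iid [Fintype V] (hμ : ∑ a, μ a = 1) {ι : Type*} [Fintype ι] [DecidableEq ι]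
    (s t : ι) (hP : P ↔ t ≠ s) (a b : V) :
    distOf (fun d : ι → V => ∏ m, μ (d m)) (fun d => (d s, d t)) (a, b) =
      μ b * resample μ P b a := by
  have h : distOf (fun d : ι → V => ∏ m, μ (d m)) (fun d => (d s, d t)) (a, b) =
      ∏ m, ∑ v, μ v * ((if m = s then (if v = a then 1 else 0) else 1) *
        (if m = t then (if v = b then 1 else 0) else 1)) := by
    rw [Finset.prod_univ_sum, Fintype.piFinset_univ, distOf]
    refine Finset.sum_congr rfl fun d _ => ?_
    rw [Finset.prod_mul_distrib, Finset.prod_mul_distrib]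
    simp only [Finset.prod_ite_eq', Finset.mem_univ, if_true, Prod.mk.injEq]
    by_cases h1 : d s = a <;> by_cases h2 : d t = b <;> simp [h1, h2]
  rw [h, resample]
  by_cases hst : t = s
  · have hnP : ¬ P := by simp [hP, hst]
    subst hst
    rw [Finset.prod_eq_single t (fun m _ hm => by simp [hm, hμ]) (by simp), if_neg hnP]
    by_cases hab : a = b
    · subst hab
      simp
    · simp [hab, eq_comm]
  · rw [if_pos (hP.2 hst), Finset.prod_eq_mul s t (Ne.symm hst)
      (fun m _ hm => by simp [hm.1, hm.2, hμ]) (by simp) (by simp)]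
    simp [hst, Ne.symm hst, mul_comm]

end Resample

/-- Resampling a product weight is resampling each coordinate. -/
theorem prod_mul_resample {V : Type*} [DecidableEq V] {n : ℕ} (μ : Fin n → V → ℝ)
    (P : Prop) [Decidable P] (b a : Fin n → V) :
    (∏ i, μ i (b i)) * resample (fun x : Fin n → V => ∏ i, μ i (x i)) P b a =
      ∏ i, μ i (b i) * resample (μ i) P (b i) (a i) := by
  rw [Finset.prod_mul_distrib]
  congr 1
  unfold resample
  split_ifs with h1 h2
  · rfl
  · simp [h2]
  · rw [Finset.prod_ite_zero, if_neg]
    simpa [funext_iff] using h2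

/-- Under typicality, empirical averages are close to expectations. -/
theorem Typical.le_sum {α : Type*} [Fintype α] [DecidableEq α] {p : α → ℝ} {ε : ℝ} {n : ℕ}
    {xs : Fin n → α} (h : Typical p ε xs) (f : α → ℝ) :
    (n : ℝ) * (∑ a, p a * f a - ε * ∑ a, p a * |f a|) ≤ ∑ i, f (xs i) := by
  rcases Nat.eq_zero_or_pos n with rfl | hn
  · simp
  have hn' : (0 : ℝ) < n := by exact_mod_cast hn
  have hsum : ∑ i, f (xs i) =
      ∑ a, ((Finset.univ.filter fun i => xs i = a).card : ℝ) * f a := by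
    rw [← Finset.sum_fiberwise (s := Finset.univ) (g := xs)]
    refine Finset.sum_congr rfl fun a _ => ?_
    rw [Finset.sum_congr rfl (g := fun _ => f a) (fun i hi => by
      rw [(Finset.mem_filter.1 hi).2]), Finset.sum_const, nsmul_eq_mul]
  rw [hsum, Finset.mul_sum, ← Finset.sum_sub_distrib, Finset.mul_sum]
  refine Finset.sum_le_sum fun a _ => ?_
  set N : ℝ := ((Finset.univ.filter fun i => xs i = a).card : ℝ)
  have h1 : |(N / n - p a) * f a| ≤ ε * p a * |f a| := by
    rw [abs_mul]
    exact mul_le_mul_of_nonneg_right (h a) (abs_nonneg _)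
  have h2 := (abs_le.1 h1).1
  have h3 : N * f a = n * (N / n * f a) := by field_simp
  rw [h3]
  refine mul_le_mul_of_nonneg_left ?_ hn'.le
  linarith

theorem Typical.pos {α : Type*} [Fintype α] [DecidableEq α] {p : α → ℝ} (hp : ∀ a, 0 ≤ p a)
    {ε : ℝ} {n : ℕ} {xs : Fin n → α} (h : Typical p ε xs) (i : Fin n) : 0 < p (xs i) := by
  refine lt_of_le_of_ne (hp _) fun h0 => ?_
  have h1 := h (xs i)
  rw [← h0] at h1
  simp only [sub_zero, mul_zero, abs_nonpos_iff, div_eq_zero_iff, Nat.cast_eq_zero,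
    Finset.card_eq_zero] at h1
  rcases h1 with h1 | h1
  · have : i ∈ Finset.univ.filter fun j => xs j = xs i := by simp
    rw [h1] at this
    simp at this
  · exact absurd i.2 (by omega)

/-- A change-of-measure bound on the weight of the typical set: if `r` is dominated by
`p * 2 ^ (-f) * g` on the support of `p` and `g` has `p`-mean at most one, then the `r`-weight of
the `p`-typical set is exponentially small with exponent close to the `p`-mean of `f`. -/
theorem sum_typical_le {α : Type*} [Fintype α] [DecidableEq α] {p r f g : α → ℝ}
    (hp : ∀ a, 0 ≤ p a) (hr : ∀ a, 0 ≤ r a) (hg : ∀ a, 0 ≤ g a)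
    (hdom : ∀ a, 0 < p a → r a ≤ p a * g a * (2 : ℝ) ^ (-f a))
    (hpg : ∑ a, p a * g a ≤ 1) (ε : ℝ) (n : ℕ) (T : (Fin n → α) → ℝ)
    (hT : ∀ xs, Typical p ε xs ∧ T xs = 1 ∨ T xs = 0) :
    ∑ xs : Fin n → α, (∏ i, r (xs i)) * T xs ≤
      (2 : ℝ) ^ (-((n : ℝ) * (∑ a, p a * f a - ε * ∑ a, p a * |f a|))) := by
  set c := (2 : ℝ) ^ (-((n : ℝ) * (∑ a, p a * f a - ε * ∑ a, p a * |f a|)))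
  have hc0 : 0 ≤ c := by positivity
  calc ∑ xs : Fin n → α, (∏ i, r (xs i)) * T xs
      ≤ ∑ xs : Fin n → α, (∏ i, p (xs i) * g (xs i)) * c := by
        refine Finset.sum_le_sum fun xs _ => ?_
        have hnn : 0 ≤ ∏ i, p (xs i) * g (xs i) :=
          Finset.prod_nonneg fun i _ => mul_nonneg (hp _) (hg _)
        rcases hT xs with ⟨hxs, hT1⟩ | hT0
        · rw [hT1, mul_one]
          calc ∏ i, r (xs i) ≤ ∏ i, p (xs i) * g (xs i) * (2 : ℝ) ^ (-f (xs i)) :=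
                Finset.prod_le_prod (fun i _ => hr _) fun i _ => hdom _ (hxs.pos hp i)
            _ = (∏ i, p (xs i) * g (xs i)) * (2 : ℝ) ^ (-∑ i, f (xs i)) := by
                rw [Finset.prod_mul_distrib, ← Finset.sum_neg_distrib,
                  Real.rpow_sum_of_pos (by norm_num)]
            _ ≤ _ := by
                refine mul_le_mul_of_nonneg_left ?_ hnn
                exact Real.rpow_le_rpow_of_exponent_le (by norm_num)
                  (neg_le_neg (hxs.le_sum f))
        · rw [hT0, mul_zero]
          exact mul_nonneg hnn hc0
    _ = (∑ a, p a * g a) ^ n * c := by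
        rw [← Finset.sum_mul, Fintype.sum_pow]
    _ ≤ 1 * c := by
        refine mul_le_mul_of_nonneg_right (pow_le_one₀ ?_ hpg) hc0
        exact Finset.sum_nonneg fun a _ => mul_nonneg (hp a) (hg a)
    _ = c := one_mul c

end FiniteProbability

section SingleLetter

set_option linter.unusedSectionVars false

/-- The marginal channel from all inputs to the output of receiver `l1`. -/
def chanMarg (l1 : Fin L) (x : ∀ k, X k) : Y l1 → ℝ := distOf (W x) (fun y => y l1)

/-- The law of the output of receiver `l1` given the time-sharing symbol `q` and the inputs `x k`
for `k ∉ B`, the inputs in `B` being averaged out. -/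
def smoothChan (l1 : Fin L) (B : Finset (Fin K)) (q : Q) (x : ∀ k, X k) (y : Y l1) : ℝ :=
  ∑ a : ∀ k, X k, (∏ k, resample (pX k q) (k ∈ B) (x k) (a k)) * chanMarg W l1 a y

/-- The joint law of the time-sharing symbol, of inputs `x`, and of the output of receiver `l1`,
when the inputs in `A` are independent copies of those actually sent. -/
def decoupledP (l1 : Fin L) (A : Finset (Fin K)) (u : Q × (∀ k, X k) × Y l1) : ℝ :=
  pQ u.1 * (∏ k, pX k u.1 (u.2.1 k)) * smoothChan pX W l1 A u.1 u.2.1 u.2.2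

variable {pQ pX W}

theorem chanMarg_nonneg (hW : ∀ x, IsPMF (W x)) (l1 : Fin L) (x : ∀ k, X k) (y : Y l1) :
    0 ≤ chanMarg W l1 x y :=
  Finset.sum_nonneg fun y' _ => by split_ifs <;> simp [(hW x).1 y']

theorem sum_chanMarg (hW : ∀ x, IsPMF (W x)) (l1 : Fin L) (x : ∀ k, X k) :
    ∑ y, chanMarg W l1 x y = 1 := by
  have h := sum_distOf_mul (W x) (fun y => y l1) (fun _ => 1)
  simp only [mul_one, (hW x).2] at h
  exact h

theorem chanMarg_pos (hW : ∀ x, IsPMF (W x)) (l1 : Fin L) (x : ∀ k, X k) (y : ∀ l, Y l)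
    (h : 0 < W x y) : 0 < chanMarg W l1 x (y l1) := by
  exact Finset.sum_pos' (fun y' _ => by split_ifs <;> simp [(hW x).1 y']) ⟨y, by simp, by simpa⟩

theorem prod_resample_nonneg (hpX : ∀ k q, IsPMF (pX k q)) (B : Finset (Fin K)) (q : Q)
    (x a : ∀ k, X k) : 0 ≤ ∏ k, resample (pX k q) (k ∈ B) (x k) (a k) :=
  Finset.prod_nonneg fun k _ => resample_nonneg _ (hpX k q).1 _ _

theorem sum_prod_resample (hpX : ∀ k q, IsPMF (pX k q)) (B : Finset (Fin K)) (q : Q)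
    (x : ∀ k, X k) : ∑ a : ∀ k, X k, ∏ k, resample (pX k q) (k ∈ B) (x k) (a k) = 1 := by
  rw [← Fintype.piFinset_univ, ← Finset.prod_univ_sum]
  exact Finset.prod_eq_one fun k _ => sum_resample _ (hpX k q).2 _

theorem smoothChan_nonneg (hpX : ∀ k q, IsPMF (pX k q)) (hW : ∀ x, IsPMF (W x)) (l1 : Fin L)
    (B : Finset (Fin K)) (q : Q) (x : ∀ k, X k) (y : Y l1) :
    0 ≤ smoothChan pX W l1 B q x y :=
  Finset.sum_nonneg fun a _ =>
    mul_nonneg (prod_resample_nonneg hpX B q x a) (chanMarg_nonneg hW l1 a y)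

theorem sum_smoothChan (hpX : ∀ k q, IsPMF (pX k q)) (hW : ∀ x, IsPMF (W x)) (l1 : Fin L)
    (B : Finset (Fin K)) (q : Q) (x : ∀ k, X k) :
    ∑ y, smoothChan pX W l1 B q x y = 1 := by
  unfold smoothChan
  rw [Finset.sum_comm]
  simp only [← Finset.mul_sum, sum_chanMarg hW, mul_one, sum_prod_resample hpX]

theorem smoothChan_empty (l1 : Fin L) (q : Q) (x : ∀ k, X k) (y : Y l1) :
    smoothChan pX W l1 ∅ q x y = chanMarg W l1 x y := by
  have h : ∀ a : ∀ k, X k, (∏ k, resample (pX k q) (k ∈ (∅ : Finset (Fin K))) (x k) (a k)) =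
      if a = x then 1 else 0 := by
    intro a
    simp only [resample, Finset.notMem_empty, if_false]
    rw [Finset.prod_ite_zero]
    simp [funext_iff]
  simp only [smoothChan, h, ite_mul, one_mul, zero_mul, Finset.sum_ite_eq', Finset.mem_univ,
    if_true]

theorem smoothChan_pos (hpX : ∀ k q, IsPMF (pX k q)) (hW : ∀ x, IsPMF (W x)) (l1 : Fin L)
    (B : Finset (Fin K)) {q : Q} {x : ∀ k, X k} {y : Y l1} (hx : ∀ k, 0 < pX k q (x k))
    (hy : 0 < chanMarg W l1 x y) : 0 < smoothChan pX W l1 B q x y := by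
  refine Finset.sum_pos' (fun a _ =>
    mul_nonneg (prod_resample_nonneg hpX B q x a) (chanMarg_nonneg hW l1 a y))
    ⟨x, Finset.mem_univ _, mul_pos (Finset.prod_pos fun k _ => resample_self_pos _ (hx k)) hy⟩

/-- `smoothChan` does not depend on the inputs in the averaged set. -/
theorem smoothChan_congr (l1 : Fin L) {A : Finset (Fin K)} {q : Q} {x x' : ∀ k, X k}
    (h : ∀ k, k ∉ A → x k = x' k) (y : Y l1) :
    smoothChan pX W l1 A q x y = smoothChan pX W l1 A q x' y := by
  unfold smoothChan
  refine Finset.sum_congr rfl fun a _ => ?_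
  congr 1
  refine Finset.prod_congr rfl fun k _ => ?_
  by_cases hk : k ∈ A
  · simp [resample, hk]
  · rw [h k hk]

theorem decoupledP_nonneg (hpQ : IsPMF pQ) (hpX : ∀ k q, IsPMF (pX k q))
    (hW : ∀ x, IsPMF (W x)) (l1 : Fin L) (A : Finset (Fin K)) (u : Q × (∀ k, X k) × Y l1) :
    0 ≤ decoupledP pQ pX W l1 A u :=
  mul_nonneg (mul_nonneg (hpQ.1 _) (Finset.prod_nonneg fun k _ => (hpX k _).1 _))
    (smoothChan_nonneg hpX hW _ _ _ _ _)

theorem sum_decoupledP (hpQ : IsPMF pQ) (hpX : ∀ k q, IsPMF (pX k q))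
    (hW : ∀ x, IsPMF (W x)) (l1 : Fin L) (A : Finset (Fin K)) :
    ∑ u : Q × (∀ k, X k) × Y l1, decoupledP pQ pX W l1 A u = 1 := by
  have h : ∀ q, ∑ x : ∀ k, X k, ∏ k, pX k q (x k) = 1 := by
    intro q
    rw [← Fintype.piFinset_univ, ← Finset.prod_univ_sum]
    exact Finset.prod_eq_one fun k _ => (hpX k q).2
  simp only [Fintype.sum_prod_type, decoupledP, ← Finset.mul_sum, sum_smoothChan hpX hW, mul_one,
    h, hpQ.2]

/-- Averaging against inputs in `B` may be done inside or outside of any function that does not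
depend on them. -/
theorem sum_mul_smoothChan (hpX : ∀ k q, IsPMF (pX k q)) (l1 : Fin L) (B : Finset (Fin K))
    (q : Q) (y : Y l1)
    (g : (∀ k, X k) → ℝ) (hg : ∀ x x' : ∀ k, X k, (∀ k, k ∉ B → x k = x' k) → g x = g x') :
    ∑ x : ∀ k, X k, (∏ k, pX k q (x k)) * smoothChan pX W l1 B q x y * g x =
      ∑ x : ∀ k, X k, (∏ k, pX k q (x k)) * chanMarg W l1 x y * g x := by
  have hone : ∀ x : ∀ k, X k, (∏ k, pX k q (x k)) * chanMarg W l1 x y * g x =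
      (∏ k, pX k q (x k)) * chanMarg W l1 x y * g x *
        ∑ a : ∀ k, X k, ∏ k, resample (pX k q) (k ∈ B) (x k) (a k) := fun x => by
    rw [sum_prod_resample hpX, mul_one]
  rw [Finset.sum_congr rfl fun x _ => hone x]
  simp only [smoothChan, Finset.mul_sum, Finset.sum_mul]
  rw [Finset.sum_comm]
  refine Finset.sum_congr rfl fun a _ => Finset.sum_congr rfl fun x _ => ?_
  have h1 : (∏ k, pX k q (x k)) * ∏ k, resample (pX k q) (k ∈ B) (x k) (a k) =
      (∏ k, pX k q (a k)) * ∏ k, resample (pX k q) (k ∈ B) (a k) (x k) := by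
    rw [← Finset.prod_mul_distrib, ← Finset.prod_mul_distrib]
    exact Finset.prod_congr rfl fun k _ => mul_resample_comm _ _ _
  by_cases h : ∀ k, k ∉ B → x k = a k
  · rw [hg x a h]
    linear_combination (chanMarg W l1 a y * g a) * h1
  · push Not at h
    obtain ⟨k, hk, hne⟩ := h
    have h2 : ∏ k, resample (pX k q) (k ∈ B) (a k) (x k) = 0 :=
      Finset.prod_eq_zero (Finset.mem_univ k) (by simp [resample, hk, hne])
    rw [h2, mul_zero] at h1
    rw [h2]
    linear_combination (chanMarg W l1 a y * g x) * h1

/-- The probability under the single-letter law of fixing the time-sharing symbol, the inputs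
outside `B` and the output of receiver `l1`. -/
theorem sum_NjointP_ite (l1 : Fin L) (B : Finset (Fin K)) (q : Q) (x : ∀ k, X k) (y : Y l1) :
    (∑ z : Q × (∀ k, X k) × (∀ l, Y l),
      if z.1 = q ∧ (∀ k, k ∉ B → z.2.1 k = x k) ∧ z.2.2 l1 = y then NjointP pQ pX W z else 0) =
      pQ q * (∏ k, if k ∈ B then 1 else pX k q (x k)) * smoothChan pX W l1 B q x y := by
  have hx : ∀ a : ∀ k, X k, (if ∀ k, k ∉ B → a k = x k then ∏ k, pX k q (a k) else 0) =
      (∏ k, if k ∈ B then 1 else pX k q (x k)) *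
        ∏ k, resample (pX k q) (k ∈ B) (x k) (a k) := by
    intro a
    rw [← Finset.prod_mul_distrib]
    split_ifs with h
    · refine Finset.prod_congr rfl fun k _ => ?_
      by_cases hk : k ∈ B
      · simp [resample, hk]
      · simp [resample, hk, h k hk]
    · push Not at h
      obtain ⟨k, hk, hne⟩ := h
      exact (Finset.prod_eq_zero (Finset.mem_univ k) (by simp [resample, hk, hne])).symm
  rw [Fintype.sum_prod_type, Finset.sum_eq_single q (fun q' _ hq' => by simp [hq']) (by simp),
    Fintype.sum_prod_type, smoothChan, Finset.mul_sum]
  refine Finset.sum_congr rfl fun a _ => ?_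
  rw [mul_assoc, ← mul_assoc (∏ k, _ : ℝ), ← hx a, chanMarg, distOf, Finset.mul_sum,
    Finset.mul_sum]
  refine Finset.sum_congr rfl fun y' _ => ?_
  by_cases h1 : ∀ k, k ∉ B → a k = x k <;> by_cases h2 : y' l1 = y <;>
    simp [h1, h2, NjointP, mul_assoc]

theorem sum_NjointP_ite_input (hpX : ∀ k q, IsPMF (pX k q)) (hW : ∀ x, IsPMF (W x))
    (l1 : Fin L) (B : Finset (Fin K)) (q : Q) (x : ∀ k, X k) :
    (∑ z : Q × (∀ k, X k) × (∀ l, Y l),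
      if z.1 = q ∧ (∀ k, k ∉ B → z.2.1 k = x k) then NjointP pQ pX W z else 0) =
      pQ q * (∏ k, if k ∈ B then 1 else pX k q (x k)) := by
  have hone := congrArg (fun r => pQ q * (∏ k, if k ∈ B then 1 else pX k q (x k)) * r)
    (sum_smoothChan hpX hW l1 B q x)
  simp only [mul_one] at hone
  rw [← hone, Finset.mul_sum,
    Finset.sum_congr rfl fun y _ => (sum_NjointP_ite (W := W) l1 B q x y).symm,
    Finset.sum_comm]
  refine Finset.sum_congr rfl fun z _ => ?_
  by_cases h : z.1 = q ∧ (∀ k, k ∉ B → z.2.1 k = x k)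
  · rw [if_pos h, Finset.sum_eq_single (z.2.2 l1) (fun y _ hy => if_neg fun h' => hy h'.2.2.symm)
      (by simp), if_pos ⟨h.1, h.2, rfl⟩]
  · rw [if_neg h, Finset.sum_eq_zero fun y _ => if_neg fun h' => h ⟨h'.1, h'.2.1⟩]

theorem distOf_NjointP (l1 : Fin L) (u : Q × (∀ k, X k) × Y l1) :
    distOf (NjointP pQ pX W) (fun z => (z.1, z.2.1, z.2.2 l1)) u =
      decoupledP pQ pX W l1 ∅ u := by
  obtain ⟨q, x, y⟩ := u
  have h := sum_NjointP_ite (pQ := pQ) (pX := pX) (W := W) l1 ∅ q x y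
  simp only [Finset.notMem_empty, not_false_eq_true, true_implies, if_false] at h
  simp only [distOf, decoupledP, Prod.mk.injEq, funext_iff]
  exact h

/-- The conditional mutual information as the mean of the information density. -/
theorem condMutInfo_NjointP (hpX : ∀ k q, IsPMF (pX k q))
    (hW : ∀ x, IsPMF (W x)) (l1 : Fin L) (B C : Finset (Fin K)) (hBC : ∀ k, k ∈ C ↔ k ∉ B) :
    condMutInfo (NjointP pQ pX W)
      (fun z => fun k : {k // k ∈ B} => z.2.1 k.1)
      (fun z => z.2.2 l1)
      (fun z => ((fun k : {k // k ∈ C} => z.2.1 k.1), z.1)) =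
    ∑ u : Q × (∀ k, X k) × Y l1, decoupledP pQ pX W l1 ∅ u *
      Real.logb 2 (chanMarg W l1 u.2.1 u.2.2 / smoothChan pX W l1 B u.1 u.2.1 u.2.2) := by
  have hall : ∀ x x' : ∀ k, X k, ((∀ k ∈ B, x k = x' k) ∧ ∀ k ∈ C, x k = x' k) ↔
      ∀ k, x k = x' k := fun x x' =>
    ⟨fun h k => if hk : k ∈ B then h.1 k hk else h.2 k ((hBC k).2 hk),
      fun h => ⟨fun k _ => h k, fun k _ => h k⟩⟩
  have hXQ : ∀ z : Q × (∀ k, X k) × (∀ l, Y l), distOf (NjointP pQ pX W)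
      (fun z => ((fun k : {k // k ∈ B} => z.2.1 k.1),
        ((fun k : {k // k ∈ C} => z.2.1 k.1), z.1)))
      ((fun k : {k // k ∈ B} => z.2.1 k.1), ((fun k : {k // k ∈ C} => z.2.1 k.1), z.1)) =
      pQ z.1 * ∏ k, pX k z.1 (z.2.1 k) := by
    intro z
    have h := sum_NjointP_ite_input (pQ := pQ) hpX hW l1 ∅ z.1 z.2.1
    simp only [Finset.notMem_empty, not_false_eq_true, true_implies, if_false] at h
    rw [← h, distOf]
    refine Finset.sum_congr rfl fun z' _ => if_congr ?_ rfl rfl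
    simp only [Prod.mk.injEq, funext_iff, Subtype.forall]
    rw [← hall]
    tauto
  have hYQ : ∀ z : Q × (∀ k, X k) × (∀ l, Y l), distOf (NjointP pQ pX W)
      (fun z => (z.2.2 l1, ((fun k : {k // k ∈ C} => z.2.1 k.1), z.1)))
      (z.2.2 l1, ((fun k : {k // k ∈ C} => z.2.1 k.1), z.1)) =
      pQ z.1 * (∏ k, if k ∈ B then 1 else pX k z.1 (z.2.1 k)) *
        smoothChan pX W l1 B z.1 z.2.1 (z.2.2 l1) := by
    intro z
    rw [← sum_NjointP_ite, distOf]
    refine Finset.sum_congr rfl fun z' _ => if_congr ?_ rfl rfl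
    simp only [Prod.mk.injEq, funext_iff, Subtype.forall, hBC]
    tauto
  have hXYQ : ∀ z : Q × (∀ k, X k) × (∀ l, Y l), distOf (NjointP pQ pX W)
      (fun z => ((fun k : {k // k ∈ B} => z.2.1 k.1), z.2.2 l1,
        ((fun k : {k // k ∈ C} => z.2.1 k.1), z.1)))
      ((fun k : {k // k ∈ B} => z.2.1 k.1), z.2.2 l1,
        ((fun k : {k // k ∈ C} => z.2.1 k.1), z.1)) =
      pQ z.1 * (∏ k, pX k z.1 (z.2.1 k)) * chanMarg W l1 z.2.1 (z.2.2 l1) := by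
    intro z
    have h := distOf_NjointP (pQ := pQ) (pX := pX) (W := W) l1 (z.1, z.2.1, z.2.2 l1)
    simp only [decoupledP, smoothChan_empty] at h
    rw [← h, distOf, distOf]
    refine Finset.sum_congr rfl fun z' _ => if_congr ?_ rfl rfl
    simp only [Prod.mk.injEq, funext_iff, Subtype.forall]
    rw [← hall]
    tauto
  have hQ : ∀ z : Q × (∀ k, X k) × (∀ l, Y l), distOf (NjointP pQ pX W)
      (fun z => ((fun k : {k // k ∈ C} => z.2.1 k.1), z.1))
      ((fun k : {k // k ∈ C} => z.2.1 k.1), z.1) =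
      pQ z.1 * ∏ k, if k ∈ B then 1 else pX k z.1 (z.2.1 k) := by
    intro z
    rw [← sum_NjointP_ite_input hpX hW l1, distOf]
    refine Finset.sum_congr rfl fun z' _ => if_congr ?_ rfl rfl
    simp only [Prod.mk.injEq, funext_iff, Subtype.forall, hBC]
    tauto
  simp only [← distOf_NjointP]
  rw [sum_distOf_mul (NjointP pQ pX W) (fun z => (z.1, z.2.1, z.2.2 l1))
    (fun u => Real.logb 2 (chanMarg W l1 u.2.1 u.2.2 / smoothChan pX W l1 B u.1 u.2.1 u.2.2))]
  simp only [condMutInfo, entOf_eq_neg_sum, hXQ, hYQ, hXYQ, hQ]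
  rw [← sub_eq_zero]
  simp only [← Finset.sum_neg_distrib, ← Finset.sum_add_distrib, ← Finset.sum_sub_distrib]
  refine Finset.sum_eq_zero fun z _ => ?_
  by_cases hz : NjointP pQ pX W z = 0
  · simp [hz]
  have h1 : pQ z.1 ≠ 0 := fun h => hz (by simp [NjointP, h])
  have h2 : ∏ k, pX k z.1 (z.2.1 k) ≠ 0 := fun h => hz (by simp [NjointP, h])
  have h3 : W z.2.1 z.2.2 ≠ 0 := fun h => hz (by simp [NjointP, h])
  have h4 : 0 < chanMarg W l1 z.2.1 (z.2.2 l1) :=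
    chanMarg_pos hW l1 _ _ (lt_of_le_of_ne ((hW _).1 _) (Ne.symm h3))
  have h2' : ∀ k, pX k z.1 (z.2.1 k) ≠ 0 := fun k => Finset.prod_ne_zero_iff.1 h2 k (by simp)
  have h5 := smoothChan_pos hpX hW l1 B
    (fun k => lt_of_le_of_ne ((hpX _ _).1 _) (Ne.symm (h2' k))) h4
  have h6 : (∏ k, if k ∈ B then 1 else pX k z.1 (z.2.1 k)) ≠ 0 :=
    Finset.prod_ne_zero_iff.2 fun k _ => by split_ifs <;> simp [h2' k]
  rw [Real.logb_mul h1 h2, Real.logb_mul (mul_ne_zero h1 h6) h5.ne', Real.logb_mul h1 h6,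
    Real.logb_mul (mul_ne_zero h1 h2) h4.ne', Real.logb_mul h1 h2,
    Real.logb_div h4.ne' h5.ne']
  ring

end SingleLetter

section ListSize

set_option linter.unusedSectionVars false

variable {pQ pX W}

/-- The single-letter law of the time-sharing symbol, the pairs (sent, tested) of inputs, and the
channel outputs, projected to what the typicality test sees. -/
theorem distOf_tested (l1 : Fin L) (A : Finset (Fin K)) (u : Q × (∀ k, X k) × Y l1) :
    distOf (fun z : Q × (∀ k, X k × X k) × (∀ l, Y l) =>
        pQ z.1 * (∏ k, pX k z.1 (z.2.1 k).2 *
          resample (pX k z.1) (k ∈ A) (z.2.1 k).2 (z.2.1 k).1) *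
          W (fun k => (z.2.1 k).1) z.2.2)
      (fun z => (z.1, fun k => (z.2.1 k).2, z.2.2 l1)) u = decoupledP pQ pX W l1 A u := by
  obtain ⟨q, x, y⟩ := u
  let e : (∀ k, X k × X k) ≃ (∀ k, X k) × (∀ k, X k) :=
    { toFun := fun p => (fun k => (p k).2, fun k => (p k).1)
      invFun := fun p k => (p.2 k, p.1 k)
      left_inv := fun _ => rfl
      right_inv := fun _ => rfl }
  rw [distOf, Fintype.sum_prod_type,
    Finset.sum_eq_single q (fun q' _ hq' => by simp [hq']) (by simp),
    Fintype.sum_prod_type, ← e.symm.sum_comp, Fintype.sum_prod_type,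
    Finset.sum_eq_single x (fun x' _ hx' => by simp [e, hx']) (by simp)]
  simp only [decoupledP, smoothChan, Finset.mul_sum, chanMarg, distOf]
  refine Finset.sum_congr rfl fun a _ => Finset.sum_congr rfl fun y' _ => ?_
  by_cases h : y' l1 = y
  · simp [e, h, Finset.prod_mul_distrib, mul_assoc]
  · simp [h]

/-- Single-letterization: averaging over codebooks and channel outputs a function of the
time-sharing sequence, the codewords with indices `t`, and the output of receiver `l1`, when the
codewords with indices `s` are sent. -/
theorem sum_codebook_eq (hpX : ∀ k q, IsPMF (pX k q)) (l1 : Fin L) {n : ℕ} {M : Fin K → ℕ}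
    (s t : ∀ k, Fin (M k)) (A : Finset (Fin K)) (hA : ∀ k, k ∈ A ↔ t k ≠ s k)
    (Φ : (Fin n → Q × (∀ k, X k) × Y l1) → ℝ) :
    ∑ c : NCodebook Q X n M, ∑ y : ∀ l, Fin n → Y l,
      NensembleP pQ pX c * (∏ i, W (fun k => c.2 k (s k) i) (fun l => y l i)) *
        Φ (fun i => (c.1 i, fun k => c.2 k (t k) i, y l1 i)) =
      ∑ u : Fin n → Q × (∀ k, X k) × Y l1, (∏ i, decoupledP pQ pX W l1 A (u i)) * Φ u := by
  have hsum : ∀ k (q : Fin n → Q), ∑ x : Fin n → X k, ∏ i, pX k (q i) (x i) = 1 := by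
    intro k q
    rw [← Fintype.piFinset_univ, ← Finset.prod_univ_sum]
    exact Finset.prod_eq_one fun i _ => (hpX k (q i)).2
  have hcode : ∀ (q : Fin n → Q) (y : ∀ l, Fin n → Y l),
      ∑ d : ∀ k, Fin (M k) → Fin n → X k,
        NensembleP pQ pX (q, d) * (∏ i, W (fun k => d k (s k) i) (fun l => y l i)) *
          Φ (fun i => (q i, fun k => d k (t k) i, y l1 i)) =
      ∑ e : ∀ k, (Fin n → X k) × (Fin n → X k),
        (∏ i, pQ (q i)) * (∏ k, ∏ i, pX k (q i) ((e k).2 i) *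
          resample (pX k (q i)) (k ∈ A) ((e k).2 i) ((e k).1 i)) *
          (∏ i, W (fun k => (e k).1 i) (fun l => y l i)) *
          Φ (fun i => (q i, fun k => (e k).2 i, y l1 i)) := by
    intro q y
    have h := sum_pi_map (fun k (d : Fin (M k) → Fin n → X k) => ∏ m, ∏ i, pX k (q i) (d m i))
      (fun k d => (d (s k), d (t k)))
      (fun e => (∏ i, pQ (q i)) * (∏ i, W (fun k => (e k).1 i) (fun l => y l i)) *
          Φ (fun i => (q i, fun k => (e k).2 i, y l1 i)))
    refine Eq.trans (Finset.sum_congr rfl fun d _ => ?_)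
      (h.trans (Finset.sum_congr rfl fun e _ => ?_))
    · simp only [NensembleP]
      ring
    · have hk : ∀ k, distOf (fun d : Fin (M k) → Fin n → X k => ∏ m, ∏ i, pX k (q i) (d m i))
          (fun d => (d (s k), d (t k))) (e k) = ∏ i, pX k (q i) ((e k).2 i) *
          resample (pX k (q i)) (k ∈ A) ((e k).2 i) ((e k).1 i) := by
        intro k
        rw [← prod_mul_resample]
        exact distOf_pair_iid (k ∈ A) (hsum k q) (s k) (t k) (hA k) (e k).1 (e k).2
      rw [Finset.prod_congr rfl fun k _ => hk k]
      ring
  let E : (Fin n → Q × (∀ k, X k × X k) × (∀ l, Y l)) ≃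
      (Fin n → Q) × (∀ l, Fin n → Y l) × (∀ k, (Fin n → X k) × (Fin n → X k)) :=
    { toFun := fun z => (fun i => (z i).1, fun l i => (z i).2.2 l,
        fun k => (fun i => ((z i).2.1 k).1, fun i => ((z i).2.1 k).2))
      invFun := fun w i => (w.1 i, fun k => ((w.2.2 k).1 i, (w.2.2 k).2 i), fun l => w.2.1 l i)
      left_inv := fun _ => rfl
      right_inv := fun _ => rfl }
  have hpush := sum_pi_map (fun (_ : Fin n) (z : Q × (∀ k, X k × X k) × (∀ l, Y l)) =>
        pQ z.1 * (∏ k, pX k z.1 (z.2.1 k).2 *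
          resample (pX k z.1) (k ∈ A) (z.2.1 k).2 (z.2.1 k).1) *
          W (fun k => (z.2.1 k).1) z.2.2)
      (fun _ z => (z.1, fun k => (z.2.1 k).2, z.2.2 l1)) Φ
  simp only [distOf_tested] at hpush
  rw [← hpush, ← E.symm.sum_comp, Fintype.sum_prod_type, Fintype.sum_prod_type]
  refine Finset.sum_congr rfl fun q _ => ?_
  rw [Finset.sum_comm, Fintype.sum_prod_type]
  refine Finset.sum_congr rfl fun y _ => ?_
  rw [hcode q y]
  refine Finset.sum_congr rfl fun e _ => ?_
  rw [Finset.prod_comm, ← Finset.prod_mul_distrib, ← Finset.prod_mul_distrib]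
  rfl

/-- The mean absolute information density between the inputs in `B` and the output of receiver
`l1`. -/
def meanAbsInfo (pQ : Q → ℝ) (pX : ∀ k, Q → X k → ℝ) (W : (∀ k, X k) → (∀ l, Y l) → ℝ)
    (l1 : Fin L) (B : Finset (Fin K)) : ℝ :=
  ∑ u : Q × (∀ k, X k) × Y l1, decoupledP pQ pX W l1 ∅ u *
    |Real.logb 2 (chanMarg W l1 u.2.1 u.2.2 / smoothChan pX W l1 B u.1 u.2.1 u.2.2)|

theorem meanAbsInfo_nonneg (hpQ : IsPMF pQ) (hpX : ∀ k q, IsPMF (pX k q))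
    (hW : ∀ x, IsPMF (W x)) (l1 : Fin L) (B : Finset (Fin K)) :
    0 ≤ meanAbsInfo pQ pX W l1 B :=
  Finset.sum_nonneg fun u _ => mul_nonneg (decoupledP_nonneg hpQ hpX hW l1 ∅ u) (abs_nonneg _)

/-- Joint typicality of decoupled sequences: if the tested inputs in `A ⊇ B` are independent of
those sent, typicality has exponent at least the conditional mutual information between the
inputs in `B` and the output. -/
theorem sum_decoupled_typical_le (hpQ : IsPMF pQ) (hpX : ∀ k q, IsPMF (pX k q))
    (hW : ∀ x, IsPMF (W x)) (l1 : Fin L) {A B C : Finset (Fin K)} (hBA : B ⊆ A)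
    (hBC : ∀ k, k ∈ C ↔ k ∉ B) (ε : ℝ) (n : ℕ)
    (T : (Fin n → Q × (∀ k, X k) × Y l1) → ℝ)
    (hT : ∀ u, Typical (distOf (NjointP pQ pX W) (fun z => (z.1, z.2.1, z.2.2 l1))) ε u ∧
      T u = 1 ∨ T u = 0) :
    ∑ u : Fin n → Q × (∀ k, X k) × Y l1, (∏ i, decoupledP pQ pX W l1 A (u i)) * T u ≤
      (2 : ℝ) ^ (-((n : ℝ) * (condMutInfo (NjointP pQ pX W)
        (fun z => fun k : {k // k ∈ B} => z.2.1 k.1)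
        (fun z => z.2.2 l1)
        (fun z => ((fun k : {k // k ∈ C} => z.2.1 k.1), z.1)) -
          ε * meanAbsInfo pQ pX W l1 B))) := by
  rw [condMutInfo_NjointP hpX hW l1 B C hBC, meanAbsInfo]
  have hdist : distOf (NjointP pQ pX W) (fun z => (z.1, z.2.1, z.2.2 l1)) =
      decoupledP pQ pX W l1 ∅ := funext (distOf_NjointP l1)
  rw [hdist] at hT
  refine sum_typical_le
    (g := fun u => smoothChan pX W l1 A u.1 u.2.1 u.2.2 / smoothChan pX W l1 B u.1 u.2.1 u.2.2)
    (decoupledP_nonneg hpQ hpX hW l1 ∅) (decoupledP_nonneg hpQ hpX hW l1 A)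
    (fun u => div_nonneg (smoothChan_nonneg hpX hW _ _ _ _ _)
      (smoothChan_nonneg hpX hW _ _ _ _ _)) ?_ ?_ ε n T hT
  · rintro ⟨q, x, y⟩ hpos
    have hne := hpos.ne'
    simp only [decoupledP, smoothChan_empty] at hne ⊢
    have h4 : chanMarg W l1 x y ≠ 0 := fun h => hne (by simp [h])
    have h4' := lt_of_le_of_ne (chanMarg_nonneg hW l1 x y) (Ne.symm h4)
    have h2 : ∏ k, pX k q (x k) ≠ 0 := fun h => hne (by simp [h])
    have h5 := smoothChan_pos hpX hW l1 B (fun k => lt_of_le_of_ne ((hpX k q).1 (x k))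
      (Ne.symm (Finset.prod_ne_zero_iff.1 h2 k (by simp)))) h4'
    rw [Real.rpow_neg (by norm_num), Real.rpow_logb (by norm_num) (by norm_num) (by positivity)]
    refine le_of_eq ?_
    field_simp
  · have hle : ∀ q (x : ∀ k, X k) y, (∏ k, pX k q (x k)) * smoothChan pX W l1 B q x y *
        (smoothChan pX W l1 A q x y / smoothChan pX W l1 B q x y) ≤
        (∏ k, pX k q (x k)) * smoothChan pX W l1 A q x y := by
      intro q x y
      have hprod : 0 ≤ ∏ k, pX k q (x k) := Finset.prod_nonneg fun k _ => (hpX k q).1 _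
      rw [mul_assoc]
      refine mul_le_mul_of_nonneg_left ?_ hprod
      by_cases h : smoothChan pX W l1 B q x y = 0
      · simpa [h] using smoothChan_nonneg hpX hW l1 A q x y
      · exact (mul_div_cancel₀ _ h).le
    rw [← sum_decoupledP hpQ hpX hW l1 A]
    simp only [Fintype.sum_prod_type, decoupledP, smoothChan_empty]
    refine Finset.sum_le_sum fun q _ => ?_
    rw [Finset.sum_comm, Finset.sum_comm (s := Finset.univ (α := ∀ k, X k))]
    refine Finset.sum_le_sum fun y _ => ?_
    have hswap := sum_mul_smoothChan (W := W) hpX l1 B q y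
      (fun x => smoothChan pX W l1 A q x y / smoothChan pX W l1 B q x y) (fun x x' h => by
        simp only [smoothChan_congr l1 h,
          smoothChan_congr l1 fun k hk => h k fun hB => hk (hBA hB)])
    simp only [mul_assoc (pQ q), ← Finset.mul_sum]
    refine mul_le_mul_of_nonneg_left ?_ (hpQ.1 q)
    rw [← hswap]
    exact Finset.sum_le_sum fun x _ => hle q x y

theorem msgSize_le (n : ℕ) {r : ℝ} (hr : 0 ≤ r) : (msgSize n r : ℝ) ≤ (2 : ℝ) ^ ((n : ℝ) * r) := by
  unfold msgSize
  rw [Nat.cast_max, Nat.cast_one]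
  exact max_le (Real.one_le_rpow (by norm_num) (by positivity)) (Nat.floor_le (by positivity))

/-- The set of senders outside `S` to which the message tuple `m'` assigns the first message. -/
def firstSet (S : Finset (Fin K)) {M : Fin K → ℕ} [∀ k, NeZero (M k)]
    (m' : ∀ k : {k // k ∈ Sᶜ}, Fin (M k.1)) : Finset (Fin K) :=
  (Finset.univ.filter fun k : {k // k ∈ Sᶜ} => m' k = 0).map (Function.Embedding.subtype _)

theorem mem_firstSet {S : Finset (Fin K)} {M : Fin K → ℕ} [∀ k, NeZero (M k)]
    {m' : ∀ k : {k // k ∈ Sᶜ}, Fin (M k.1)} {k : Fin K} :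
    k ∈ firstSet S m' ↔ ∃ h : k ∈ Sᶜ, m' ⟨k, h⟩ = 0 := by
  simp [firstSet]

theorem card_firstSet_eq_le (S U : Finset (Fin K)) (n : ℕ) {R : Fin K → ℝ} (hR : ∀ k, 0 ≤ R k) :
    ((Finset.univ.filter fun m' : ∀ k : {k // k ∈ Sᶜ}, Fin (msgSize n (R k.1)) =>
      firstSet (M := fun k => msgSize n (R k)) S m' = U).card : ℝ) ≤
      (2 : ℝ) ^ ((n : ℝ) * ∑ k ∈ Sᶜ \ U, R k) := by
  have hcard : (Finset.univ.filter fun m' : ∀ k : {k // k ∈ Sᶜ}, Fin (msgSize n (R k.1)) =>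
      firstSet (M := fun k => msgSize n (R k)) S m' = U).card ≤
      (Finset.univ : Finset (∀ k : {k // k ∈ Sᶜ \ U}, Fin (msgSize n (R k.1)))).card := by
    refine Finset.card_le_card_of_injOn
      (fun m' k => m' ⟨k.1, (Finset.mem_sdiff.1 k.2).1⟩) (by simp) ?_
    intro m₁ h₁ m₂ h₂ h
    simp only [Finset.coe_filter, Finset.mem_univ, true_and, Set.mem_ofPred_eq] at h₁ h₂
    funext k
    by_cases hk : k.1 ∈ U
    · obtain ⟨_, e₁⟩ := mem_firstSet.1 (h₁.symm ▸ hk)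
      obtain ⟨_, e₂⟩ := mem_firstSet.1 (h₂.symm ▸ hk)
      exact e₁.trans e₂.symm
    · exact congrFun h ⟨k.1, Finset.mem_sdiff.2 ⟨k.2, hk⟩⟩
  calc _ ≤ ((Finset.univ : Finset (∀ k : {k // k ∈ Sᶜ \ U}, Fin (msgSize n (R k.1)))).card : ℝ) :=
        by exact_mod_cast hcard
    _ = ∏ k : {k // k ∈ Sᶜ \ U}, (msgSize n (R k.1) : ℝ) := by simp
    _ = ∏ k ∈ Sᶜ \ U, (msgSize n (R k) : ℝ) :=
        Finset.prod_coe_sort (Sᶜ \ U) fun k => (msgSize n (R k) : ℝ)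
    _ ≤ ∏ k ∈ Sᶜ \ U, (2 : ℝ) ^ ((n : ℝ) * R k) :=
        Finset.prod_le_prod (fun k _ => by positivity) fun k _ => msgSize_le n (hR k)
    _ = _ := by rw [Finset.mul_sum, Real.rpow_sum_of_pos (by norm_num)]

end ListSize

/-- **Generalized expected list-size bound (Equation (19)).** With `M_k = 1` for `k ∈ Sᶜ`,
let `L` be the set of tuples `m_{Sᶜ}` such that the time-sharing sequence, the transmitted
codewords of the senders in `D1`, the codewords `x_k^n(m_k)` with `m_k = 1` for
`k ∈ D1ᶜ ∩ S`, and the received sequence `Y1^n` are jointly `ε`-typical. There is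
`δ(ε) → 0` (as `ε → 0`) such that for all `n`,
`E|L| ≤ ∑_{U ⊆ Sᶜ} 2^{n (R_{Sᶜ \ U} - I(X_{Sᶜ \ U}; Y1 | X_S, X_U, Q) + δ(ε))}`. -/
theorem expected_list_size_bound_network
    (l1 : Fin L) (D1 S : Finset (Fin K)) (hD1S : D1 ⊆ S)
    (R : Fin K → ℝ) (hR : ∀ k, 0 ≤ R k)
    (hpQ : IsPMF pQ) (hpX : ∀ k q, IsPMF (pX k q)) (hW : ∀ x, IsPMF (W x)) :
    ∃ δ : ℝ → ℝ, Tendsto δ (nhdsWithin 0 (Set.Ioi 0)) (nhds 0) ∧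
      ∀ ε ∈ Set.Ioo (0 : ℝ) 1, ∀ n : ℕ,
        (∑ ω : NExpSpaceS Q X Y S n (fun k => msgSize n (R k)),
          NexpPS pQ pX W S ω *
            (Nat.card {m' : ∀ k : {k // k ∈ Sᶜ}, Fin (msgSize n (R k.1)) //
              Typical (distOf (NjointP pQ pX W) (fun z => (z.1, z.2.1, z.2.2 l1))) ε
                (fun i => (ω.1.1 i,
                  fun k => if h : k ∈ D1 then ω.1.2 k (ω.2.1 ⟨k, hD1S h⟩) i
                    else if h2 : k ∈ S then ω.1.2 k 0 i
                    else ω.1.2 k (m' ⟨k, Finset.mem_compl.mpr h2⟩) i,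
                  ω.2.2 l1 i))} : ℝ)) ≤
          ∑ U ∈ Sᶜ.powerset, (2 : ℝ) ^ ((n : ℝ) * ((∑ k ∈ Sᶜ \ U, R k) -
            condMutInfo (NjointP pQ pX W)
              (fun z => fun k : {k // k ∈ Sᶜ \ U} => z.2.1 k.1)
              (fun z => z.2.2 l1)
              (fun z => ((fun k : {k // k ∈ S ∪ U} => z.2.1 k.1), z.1)) + δ ε)) := by
  classical
  refine ⟨fun ε => ε * ∑ B : Finset (Fin K), meanAbsInfo pQ pX W l1 B, ?_, ?_⟩
  · have h : Continuous fun ε : ℝ => ε * ∑ B : Finset (Fin K), meanAbsInfo pQ pX W l1 B := by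
      fun_prop
    have h0 := h.tendsto 0
    rw [zero_mul] at h0
    exact h0.mono_left nhdsWithin_le_nhds
  intro ε hε n
  set M : Fin K → ℕ := fun k => msgSize n (R k)
  set p1 := distOf (NjointP pQ pX W) (fun z => (z.1, z.2.1, z.2.2 l1))
  set δ : ℝ := ε * ∑ B : Finset (Fin K), meanAbsInfo pQ pX W l1 B
  set I : Finset (Fin K) → ℝ := fun U => condMutInfo (NjointP pQ pX W)
    (fun z => fun k : {k // k ∈ Sᶜ \ U} => z.2.1 k.1)
    (fun z => z.2.2 l1)
    (fun z => ((fun k : {k // k ∈ S ∪ U} => z.2.1 k.1), z.1))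
  let sent (m : ∀ k : {k // k ∈ S}, Fin (M k.1)) (k : Fin K) : Fin (M k) :=
    if h : k ∈ S then m ⟨k, h⟩ else 0
  let tested (m : ∀ k : {k // k ∈ S}, Fin (M k.1)) (m' : ∀ k : {k // k ∈ Sᶜ}, Fin (M k.1))
      (k : Fin K) : Fin (M k) :=
    if h : k ∈ D1 then m ⟨k, hD1S h⟩ else if h2 : k ∈ S then 0
      else m' ⟨k, Finset.mem_compl.mpr h2⟩
  let T (u : Fin n → Q × (∀ k, X k) × Y l1) : ℝ := if Typical p1 ε u then 1 else 0
  have hT : ∀ u, Typical p1 ε u ∧ T u = 1 ∨ T u = 0 := fun u => by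
    by_cases h : Typical p1 ε u
    · exact Or.inl ⟨h, if_pos h⟩
    · exact Or.inr (if_neg h)
  have key : ∀ (m : ∀ k : {k // k ∈ S}, Fin (M k.1)) (m' : ∀ k : {k // k ∈ Sᶜ}, Fin (M k.1)),
      ∑ c : NCodebook Q X n M, ∑ y : ∀ l, Fin n → Y l,
        NensembleP pQ pX c * (∏ i, W (fun k => c.2 k (sent m k) i) (fun l => y l i)) *
          T (fun i => (c.1 i, fun k => c.2 k (tested m m' k) i, y l1 i)) ≤
        (2 : ℝ) ^ (-((n : ℝ) * (I (firstSet S m') - δ))) := by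
    intro m m'
    rw [sum_codebook_eq hpX l1 (sent m) (tested m m')
      (Finset.univ.filter fun k => tested m m' k ≠ sent m k) (by simp) T]
    refine (sum_decoupled_typical_le hpQ hpX hW l1 (B := Sᶜ \ firstSet S m')
      (C := S ∪ firstSet S m') ?_ ?_ ε n T hT).trans ?_
    · intro k hk
      obtain ⟨hkS, hkU⟩ := Finset.mem_sdiff.1 hk
      have hkS' := Finset.mem_compl.1 hkS
      have hkD : k ∉ D1 := fun h => hkS' (hD1S h)
      have hne : m' ⟨k, hkS⟩ ≠ 0 := fun h => hkU (mem_firstSet.2 ⟨hkS, h⟩)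
      simpa [sent, tested, hkS', hkD] using hne
    · intro k
      simp only [Finset.mem_union, Finset.mem_sdiff, Finset.mem_compl]
      tauto
    · refine Real.rpow_le_rpow_of_exponent_le (by norm_num) (neg_le_neg ?_)
      refine mul_le_mul_of_nonneg_left (sub_le_sub_left ?_ _) (Nat.cast_nonneg n)
      refine mul_le_mul_of_nonneg_left ?_ hε.1.le
      exact Finset.single_le_sum (f := fun B => meanAbsInfo pQ pX W l1 B)
        (fun B _ => meanAbsInfo_nonneg hpQ hpX hW l1 B) (Finset.mem_univ _)
  have hMpos : ∏ k : {k // k ∈ S}, (M k.1 : ℝ) ≠ 0 :=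
    Finset.prod_ne_zero_iff.2 fun k _ => Nat.cast_ne_zero.2 (NeZero.ne (msgSize n (R k.1)))
  have hexp : ∀ (ω : NExpSpaceS Q X Y S n M),
      NexpPS pQ pX W S ω *
        (Nat.card {m' : ∀ k : {k // k ∈ Sᶜ}, Fin (M k.1) //
          Typical p1 ε (fun i => (ω.1.1 i,
            fun k => if h : k ∈ D1 then ω.1.2 k (ω.2.1 ⟨k, hD1S h⟩) i
              else if h2 : k ∈ S then ω.1.2 k 0 i
              else ω.1.2 k (m' ⟨k, Finset.mem_compl.mpr h2⟩) i,
            ω.2.2 l1 i))} : ℝ) =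
      ∑ m' : ∀ k : {k // k ∈ Sᶜ}, Fin (M k.1), (∏ k : {k // k ∈ S}, (M k.1 : ℝ))⁻¹ *
        (NensembleP pQ pX ω.1 *
          (∏ i, W (fun k => ω.1.2 k (sent ω.2.1 k) i) (fun l => ω.2.2 l i)) *
          T (fun i => (ω.1.1 i, fun k => ω.1.2 k (tested ω.2.1 m' k) i, ω.2.2 l1 i))) := by
    intro ω
    have hsent : ∀ i k, (if h : k ∈ S then ω.1.2 k (ω.2.1 ⟨k, h⟩) i else ω.1.2 k 0 i) =
        ω.1.2 k (sent ω.2.1 k) i := by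
      intro i k
      simp only [sent]
      split_ifs <;> rfl
    have htested : ∀ (m' : ∀ k : {k // k ∈ Sᶜ}, Fin (M k.1)) i k,
        (if h : k ∈ D1 then ω.1.2 k (ω.2.1 ⟨k, hD1S h⟩) i
          else if h2 : k ∈ S then ω.1.2 k 0 i
          else ω.1.2 k (m' ⟨k, Finset.mem_compl.mpr h2⟩) i) =
        ω.1.2 k (tested ω.2.1 m' k) i := by
      intro m' i k
      simp only [tested]
      split_ifs <;> rfl
    simp only [NexpPS, hsent, htested]
    rw [Nat.card_eq_fintype_card, Fintype.card_subtype, Finset.card_filter, Nat.cast_sum,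
      Finset.mul_sum]
    refine Finset.sum_congr rfl fun m' _ => ?_
    simp only [T, Nat.cast_ite, Nat.cast_one, Nat.cast_zero]
    ring
  rw [Finset.sum_congr rfl fun ω _ => hexp ω, Finset.sum_comm]
  calc _ = ∑ m' : ∀ k : {k // k ∈ Sᶜ}, Fin (M k.1), ∑ m : ∀ k : {k // k ∈ S}, Fin (M k.1),
        (∏ k : {k // k ∈ S}, (M k.1 : ℝ))⁻¹ *
          ∑ c : NCodebook Q X n M, ∑ y : ∀ l, Fin n → Y l,
            NensembleP pQ pX c * (∏ i, W (fun k => c.2 k (sent m k) i) (fun l => y l i)) *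
              T (fun i => (c.1 i, fun k => c.2 k (tested m m' k) i, y l1 i)) := by
        refine Finset.sum_congr rfl fun m' _ => ?_
        rw [Fintype.sum_prod_type, Finset.sum_comm, Fintype.sum_prod_type]
        refine Finset.sum_congr rfl fun m _ => ?_
        rw [Finset.sum_comm]
        simp only [Finset.mul_sum]
        rfl
    _ ≤ ∑ m' : ∀ k : {k // k ∈ Sᶜ}, Fin (M k.1), ∑ m : ∀ k : {k // k ∈ S}, Fin (M k.1),
        (∏ k : {k // k ∈ S}, (M k.1 : ℝ))⁻¹ *
          (2 : ℝ) ^ (-((n : ℝ) * (I (firstSet S m') - δ))) :=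
        Finset.sum_le_sum fun m' _ => Finset.sum_le_sum fun m _ =>
          mul_le_mul_of_nonneg_left (key m m') (by positivity)
    _ = ∑ m' : ∀ k : {k // k ∈ Sᶜ}, Fin (M k.1),
          (2 : ℝ) ^ (-((n : ℝ) * (I (firstSet S m') - δ))) := by
        refine Finset.sum_congr rfl fun m' _ => ?_
        rw [Finset.sum_const, nsmul_eq_mul, Finset.card_univ, Fintype.card_pi, ← mul_assoc]
        simp only [Fintype.card_fin, Nat.cast_prod]
        rw [mul_inv_cancel₀ hMpos, one_mul]
    _ = ∑ U ∈ Sᶜ.powerset, ((Finset.univ.filter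
          fun m' : ∀ k : {k // k ∈ Sᶜ}, Fin (M k.1) => firstSet S m' = U).card : ℝ) *
          (2 : ℝ) ^ (-((n : ℝ) * (I U - δ))) := by
        rw [← Finset.sum_fiberwise_of_maps_to (s := Finset.univ) (t := Sᶜ.powerset)
          (g := fun m' : ∀ k : {k // k ∈ Sᶜ}, Fin (M k.1) => firstSet S m')
          (fun m' _ => Finset.mem_powerset.2 fun k hk => (mem_firstSet.1 hk).1)]
        refine Finset.sum_congr rfl fun U _ => ?_
        rw [Finset.sum_congr rfl (g := fun _ => (2 : ℝ) ^ (-((n : ℝ) * (I U - δ))))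
          (fun m' hm' => by rw [(Finset.mem_filter.1 hm').2]), Finset.sum_const, nsmul_eq_mul]
    _ ≤ _ := by
        refine Finset.sum_le_sum fun U _ => ?_
        refine (mul_le_mul_of_nonneg_right (card_firstSet_eq_le S U n hR)
          (by positivity)).trans (le_of_eq ?_)
        rw [← Real.rpow_add (by norm_num)]
        congr 1
        ring

end Network
end
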